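/- Let a, b > 0 and let f(r) = a r^{-12} - b r^{-6}. If 0 < V ≤ (2a/b)^{1/3}, then for every two-dimensional lattice L of co-volume V, E_f[L] ≥ E_f[√V·A₂], with equality if and only if L = O·(√V·A₂) for some orthogonal transformation O of ℝ²; that is, the triangular lattice √V·A₂ is the unique minimizer of E_f among lattices of co-volume V, up to rotation. -/

import Mathlib

open scoped Pointwise

noncomputable section

/-- A point of the Euclidean plane with coordinates `a`, `b`. -/
def vec2 (a b : ℝ) : EuclideanSpace ℝ (Fin 2) := (WithLp.equiv 2 (Fin 2 → ℝ)).symm ![a, b]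

/-- The lattice (as a set of points) generated by `u` and `v`. -/
def latticeSet (u v : EuclideanSpace ℝ (Fin 2)) : Set (EuclideanSpace ℝ (Fin 2)) :=
  {p | ∃ m n : ℤ, p = (m : ℝ) • u + (n : ℝ) • v}

/-- The determinant of the pair of plane vectors `(u, v)`. -/
def det2 (u v : EuclideanSpace ℝ (Fin 2)) : ℝ := u 0 * v 1 - u 1 * v 0

/-- `L` is a two-dimensional lattice, i.e. `L = ℤu ⊕ ℤv` for a basis `(u,v)` of ℝ². -/
def IsLattice2 (L : Set (EuclideanSpace ℝ (Fin 2))) : Prop :=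
  ∃ u v : EuclideanSpace ℝ (Fin 2), det2 u v ≠ 0 ∧ L = latticeSet u v

/-- `L` is a two-dimensional lattice of co-volume `V = |det(u,v)|`. -/
def IsLattice2OfCovol (L : Set (EuclideanSpace ℝ (Fin 2))) (V : ℝ) : Prop :=
  ∃ u v : EuclideanSpace ℝ (Fin 2), det2 u v ≠ 0 ∧ |det2 u v| = V ∧ L = latticeSet u v

/-- The Epstein zeta function of a set of points: `ζ_L(s) = Σ'_{p ∈ L, p ≠ 0} |p|^{-s}`. -/
def epsteinZeta (L : Set (EuclideanSpace ℝ (Fin 2))) (s : ℝ) : ℝ :=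
  ∑' p : ↥(L \ {0}), ‖(p : EuclideanSpace ℝ (Fin 2))‖ ^ (-s)

/-- The Lennard-Jones type energy `E_f[L] = Σ'_{p ∈ L, p ≠ 0} (a|p|^{-α} - b|p|^{-β})`. -/
def LJenergy (a b α β : ℝ) (L : Set (EuclideanSpace ℝ (Fin 2))) : ℝ :=
  ∑' p : ↥(L \ {0}),
    (a * ‖(p : EuclideanSpace ℝ (Fin 2))‖ ^ (-α) - b * ‖(p : EuclideanSpace ℝ (Fin 2))‖ ^ (-β))

/-- The triangular lattice `A₂ = √(2/√3)·[ℤ(1,0) ⊕ ℤ(1/2,√3/2)]`, of co-volume 1. -/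
def triangularLattice : Set (EuclideanSpace ℝ (Fin 2)) :=
  latticeSet (Real.sqrt (2 / Real.sqrt 3) • vec2 1 0)
    (Real.sqrt (2 / Real.sqrt 3) • vec2 (1 / 2) (Real.sqrt 3 / 2))

/-- The square lattice `ℤ² = ℤ(1,0) ⊕ ℤ(0,1)`. -/
def squareLattice : Set (EuclideanSpace ℝ (Fin 2)) := latticeSet (vec2 1 0) (vec2 0 1)

/-- `L` is the image of `L'` under an orthogonal transformation of ℝ². -/
def IsRotationOf (L L' : Set (EuclideanSpace ℝ (Fin 2))) : Prop :=
  ∃ O : EuclideanSpace ℝ (Fin 2) ≃ₗᵢ[ℝ] EuclideanSpace ℝ (Fin 2), L = O '' L'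

/-- The unit co-volume lattice parametrized by `(x, y)` in the half-fundamental domain:
`ℤu ⊕ ℤv` with `u = (1/√y, 0)` and `v = (x/√y, √y)`. -/
def latticeXY (x y : ℝ) : Set (EuclideanSpace ℝ (Fin 2)) :=
  latticeSet (vec2 (1 / Real.sqrt y) 0) (vec2 (x / Real.sqrt y) (Real.sqrt y))

/-- The Riemann zeta function `ζ(s) = Σ_{m ≥ 1} m^{-s}` (real variable version). -/
def riemannZetaReal (s : ℝ) : ℝ := ∑' n : ℕ+, (n : ℝ) ^ (-s)

end

/-- The norm form `m² + mn + n²` of the Eisenstein integers. -/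
def eisNorm (v : ℤ × ℤ) : ℤ := v.1 ^ 2 + v.1 * v.2 + v.2 ^ 2

/-- The cubed inverse Eisenstein norm, with the vectors of norm `0`, `1` and `4` left out. -/
def outerWeight (v : ℤ × ℤ) : ℚ :=
  if eisNorm v = 0 ∨ eisNorm v = 1 ∨ eisNorm v = 4 then 0 else 1 / (eisNorm v : ℚ) ^ 3

lemma eisNorm_nonneg (v : ℤ × ℤ) : 0 ≤ eisNorm v := by
  unfold eisNorm
  nlinarith [sq_nonneg (v.1 + v.2), sq_nonneg v.1, sq_nonneg v.2]

lemma outerWeight_nonneg (v : ℤ × ℤ) : 0 ≤ outerWeight v := by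
  have h : (0 : ℚ) ≤ eisNorm v := by exact_mod_cast eisNorm_nonneg v
  unfold outerWeight
  split_ifs
  · exact le_rfl
  · positivity

lemma eisNorm_eq_zero {v : ℤ × ℤ} (h : eisNorm v = 0) : v = 0 := by
  obtain ⟨m, n⟩ := v
  simp only [eisNorm] at h
  have hm : m = 0 := by
    by_contra hne
    have := sq_nonneg (m + 2 * n)
    have : 0 < m ^ 2 := by positivity
    nlinarith
  have hn : n = 0 := by
    subst hm
    simpa using h
  simp [hm, hn]

/-- The six vectors of Eisenstein norm `1`. -/
def hexagon : Finset (ℤ × ℤ) := {(1, 0), (-1, 0), (0, 1), (0, -1), (1, -1), (-1, 1)}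

/-- The six vectors of Eisenstein norm `4`. -/
def doubleHexagon : Finset (ℤ × ℤ) := {(2, 0), (-2, 0), (0, 2), (0, -2), (2, -2), (-2, 2)}

lemma mem_hexagon_of_eisNorm {v : ℤ × ℤ} (h : eisNorm v = 1) : v ∈ hexagon := by
  obtain ⟨m, n⟩ := v
  simp only [eisNorm] at h
  have h1 : m ≤ 1 := by nlinarith [sq_nonneg (m + 2 * n)]
  have h2 : -1 ≤ m := by nlinarith [sq_nonneg (m + 2 * n)]
  have h3 : n ≤ 1 := by nlinarith [sq_nonneg (2 * m + n)]
  have h4 : -1 ≤ n := by nlinarith [sq_nonneg (2 * m + n)]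
  interval_cases m <;> interval_cases n <;> first | decide | omega

lemma mem_doubleHexagon_of_eisNorm {v : ℤ × ℤ} (h : eisNorm v = 4) : v ∈ doubleHexagon := by
  obtain ⟨m, n⟩ := v
  simp only [eisNorm] at h
  have h1 : m ≤ 2 := by nlinarith [sq_nonneg (m + 2 * n)]
  have h2 : -2 ≤ m := by nlinarith [sq_nonneg (m + 2 * n)]
  have h3 : n ≤ 2 := by nlinarith [sq_nonneg (2 * m + n)]
  have h4 : -2 ≤ n := by nlinarith [sq_nonneg (2 * m + n)]
  interval_cases m <;> interval_cases n <;> first | decide | omega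

lemma eisNorm_of_mem_hexagon : ∀ v ∈ hexagon, eisNorm v = 1 := by decide

lemma eisNorm_of_mem_doubleHexagon : ∀ v ∈ doubleHexagon, eisNorm v = 4 := by decide

lemma hasSum_ite_mem_const {ι : Type*} [DecidableEq ι] (s : Finset ι) (c : ℝ) :
    HasSum (fun i => if i ∈ s then c else 0) (s.card * c) := by
  have h : HasSum (fun i => if i ∈ s then c else 0) (∑ i ∈ s, if i ∈ s then c else 0) :=
    hasSum_sum_of_ne_finset_zero fun i hi => if_neg hi
  convert h using 1
  rw [Finset.sum_congr rfl (fun i hi => if_pos hi)]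
  simp

/-! ### The weight of the outer shells -/

lemma outerWeight_le_of_mem_box {v : ℤ × ℤ} {k : ℕ} (hk : 0 < k)
    (hv : v ∈ Finset.box (α := ℤ × ℤ) k) : outerWeight v ≤ 64 / 27 / (k : ℚ) ^ 6 := by
  have hkq : (0 : ℚ) < k := by exact_mod_cast hk
  have hM : 3 * (k : ℤ) ^ 2 ≤ 4 * eisNorm v := by
    rw [Int.mem_box] at hv
    unfold eisNorm
    rcases max_choice v.1.natAbs v.2.natAbs with h | h
    · have : (k : ℤ) ^ 2 = v.1 ^ 2 := by
        rw [← hv, h, Int.natCast_natAbs, sq_abs]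
      nlinarith [sq_nonneg (v.1 + 2 * v.2)]
    · have : (k : ℤ) ^ 2 = v.2 ^ 2 := by
        rw [← hv, h, Int.natCast_natAbs, sq_abs]
      nlinarith [sq_nonneg (2 * v.1 + v.2)]
  have hM' : 3 / 4 * (k : ℚ) ^ 2 ≤ eisNorm v := by
    have : (3 * (k : ℚ) ^ 2) ≤ 4 * eisNorm v := by exact_mod_cast hM
    linarith
  unfold outerWeight
  split_ifs
  · positivity
  · calc 1 / (eisNorm v : ℚ) ^ 3 ≤ 1 / (3 / 4 * (k : ℚ) ^ 2) ^ 3 := by gcongr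
      _ = 64 / 27 / (k : ℚ) ^ 6 := by field_simp; norm_num

lemma sum_outerWeight_box_le (k : ℕ) (hk : 0 < k) :
    ∑ v ∈ Finset.box (α := ℤ × ℤ) k, outerWeight v ≤ 19 / (k : ℚ) ^ 5 := by
  have hkq : (0 : ℚ) < k := by exact_mod_cast hk
  calc ∑ v ∈ Finset.box (α := ℤ × ℤ) k, outerWeight v
      ≤ ∑ v ∈ Finset.box (α := ℤ × ℤ) k, 64 / 27 / (k : ℚ) ^ 6 :=
        Finset.sum_le_sum fun v hv => outerWeight_le_of_mem_box hk hv
    _ = 512 / 27 / (k : ℚ) ^ 5 := by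
        rw [Finset.sum_const, Int.card_box hk.ne', nsmul_eq_mul]
        push_cast
        field_simp
        norm_num
    _ ≤ 19 / (k : ℚ) ^ 5 := by gcongr; norm_num

lemma sum_outerWeight_square_le (k : ℕ) :
    ∑ v ∈ Finset.Icc (-((k + 5 : ℕ) : ℤ × ℤ)) ((k + 5 : ℕ) : ℤ × ℤ), outerWeight v ≤
      29 / 100 - 19 / 4 / (k + 5 : ℚ) ^ 4 := by
  induction k with
  | zero =>
    have h : ∑ v ∈ Finset.Icc (-5 : ℤ) 5 ×ˢ Finset.Icc (-5 : ℤ) 5, outerWeight v ≤ 281 / 1000 := by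
      decide +kernel
    refine le_trans (le_of_eq ?_) (h.trans (by norm_num))
    rfl
  | succ k ih =>
    have hstep := Finset.box_succ_disjUnion (α := ℤ × ℤ) (k + 5)
    have hb := sum_outerWeight_box_le (k + 5 + 1) (by omega)
    have e : k + 1 + 5 = (k + 5).succ := by omega
    rw [e, ← hstep, Finset.sum_disjUnion]
    have key : 19 / ((k + 5 + 1 : ℕ) : ℚ) ^ 5 + 19 / 4 / ((k : ℚ) + 1 + 5) ^ 4 ≤
        19 / 4 / (k + 5 : ℚ) ^ 4 := by
      have hk : (0 : ℚ) ≤ k := by positivity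
      push_cast
      generalize hx : (k : ℚ) + 5 = x
      have hx0 : 0 < x := by linarith
      have e2 : (k : ℚ) + 1 + 5 = x + 1 := by linarith
      rw [e2, div_add_div _ _ (by positivity) (by positivity),
        div_le_div_iff₀ (by positivity) (by positivity)]
      have : 0 ≤ x ^ 3 * (x + 1) ^ 4 := by positivity
      have p : ∀ i : ℕ, 0 ≤ x ^ i := fun i => by positivity
      nlinarith [p 1, p 2, p 3, p 4, p 5, p 6, p 7, p 8, p 9]
    push_cast at key hb ih ⊢
    linarith

lemma sum_outerWeight_le (s : Finset (ℤ × ℤ)) : ∑ v ∈ s, (outerWeight v : ℝ) ≤ 29 / 100 := by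
  obtain ⟨k, hk⟩ : ∃ k : ℕ, s ⊆
      Finset.Icc (-((k + 5 : ℕ) : ℤ × ℤ)) ((k + 5 : ℕ) : ℤ × ℤ) := by
    refine ⟨s.sup fun v => max v.1.natAbs v.2.natAbs, fun v hv => ?_⟩
    have h := Finset.le_sup (f := fun v : ℤ × ℤ => max v.1.natAbs v.2.natAbs) hv
    generalize (s.sup fun v : ℤ × ℤ => max v.1.natAbs v.2.natAbs) = k at h ⊢
    simp only [max_le_iff] at h
    rw [Finset.mem_Icc, Prod.le_def, Prod.le_def]
    simp only [Prod.fst_neg, Prod.snd_neg, Prod.fst_natCast, Prod.snd_natCast]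
    push_cast
    omega
  have h1 : ∑ v ∈ s, outerWeight v ≤ 29 / 100 := by
    refine (Finset.sum_le_sum_of_subset_of_nonneg hk fun v _ _ => outerWeight_nonneg v).trans ?_
    refine (sum_outerWeight_square_le k).trans ?_
    have : (0 : ℚ) ≤ 19 / 4 / (k + 5 : ℚ) ^ 4 := by positivity
    linarith
  have h2 : ((∑ v ∈ s, outerWeight v : ℚ) : ℝ) ≤ ((29 / 100 : ℚ) : ℝ) := Rat.cast_le.2 h1
  push_cast at h2
  exact h2

lemma summable_outerWeight : Summable fun v => (outerWeight v : ℝ) :=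
  summable_of_sum_le (fun v => Rat.cast_nonneg.2 (outerWeight_nonneg v)) sum_outerWeight_le

lemma tsum_outerWeight_le : ∑' v, (outerWeight v : ℝ) ≤ 29 / 100 :=
  Real.tsum_le_of_sum_le (fun v => Rat.cast_nonneg.2 (outerWeight_nonneg v)) sum_outerWeight_le

/-! ### Three positive numbers with prescribed first and second elementary symmetric functions -/

lemma exists_scale {σ : ℝ} (h : 3 ≤ σ) :
    ∃ l : ℝ, 0 < l ∧ l ≤ 1 ∧ σ = 3 / 2 * (l + 1 / l) := by
  have hs : 0 ≤ σ ^ 2 / 9 - 1 := by nlinarith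
  have hsq := Real.sq_sqrt hs
  have h0 := Real.sqrt_nonneg (σ ^ 2 / 9 - 1)
  set s := Real.sqrt (σ ^ 2 / 9 - 1)
  have hpos : 0 < σ / 3 - s := by nlinarith
  refine ⟨σ / 3 - s, hpos, by nlinarith, ?_⟩
  have e : (σ / 3 - s) * (σ / 3 + s) = 1 := by nlinarith
  rw [one_div, ← eq_inv_of_mul_eq_one_right e]
  ring

lemma sum_inv_cube_eq {x y z : ℝ} (hx : x ≠ 0) (hy : y ≠ 0) (hz : z ≠ 0) :
    x⁻¹ ^ 3 + y⁻¹ ^ 3 + z⁻¹ ^ 3 =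
      (x * y + y * z + z * x) ^ 3 * (x * y * z)⁻¹ ^ 3 -
        3 * (x + y + z) * (x * y + y * z + z * x) * (x * y * z)⁻¹ ^ 2 + 3 * (x * y * z)⁻¹ := by
  field_simp
  ring

/-- With the sum and the sum of pairwise products fixed, `∑ x⁻³` decreases in the product. -/
lemma sum_inv_cube_mono {e₁ e₂ y z : ℝ} (h₂ : 0 < e₂) (hz0 : 0 < z) (hzy : z ≤ y)
    (hsz : 3 * e₁ ≤ e₂ ^ 2 * z) :
    e₂ ^ 3 * z ^ 3 - 3 * e₁ * e₂ * z ^ 2 + 3 * z ≤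
      e₂ ^ 3 * y ^ 3 - 3 * e₁ * e₂ * y ^ 2 + 3 * y := by
  have hy0 : 0 < y := hz0.trans_le hzy
  have hsy : 3 * e₁ ≤ e₂ ^ 2 * y := hsz.trans (by gcongr)
  have k1 : 0 ≤ e₂ * z * (e₂ ^ 2 * z - 3 * e₁) :=
    mul_nonneg (by positivity) (by linarith)
  have k2 : 0 ≤ e₂ * y * (e₂ ^ 2 * y - 3 * e₁) :=
    mul_nonneg (by positivity) (by linarith)
  have k3 : 0 ≤ e₂ ^ 3 * (y * z) + 3 := by positivity
  have k4 := mul_nonneg (sub_nonneg.2 hzy) (add_nonneg (add_nonneg k1 k2) k3)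
  linear_combination k4

/-- For given sum and sum of pairwise products, `∑ u⁻³` is largest when the two larger of the
three numbers coincide. -/
lemma sum_inv_cube_le {l u₁ u₂ u₃ : ℝ} (hl : 0 < l) (hl1 : l ≤ 1) (h₁ : 0 < u₁) (h₂ : 0 < u₂)
    (h₃ : 0 < u₃) (hs : u₁ + u₂ + u₃ = 3 / 2 * (l + 1 / l))
    (hp : u₁ * u₂ + u₂ * u₃ + u₃ * u₁ = ((u₁ + u₂ + u₃) ^ 2 + 3) / 4) :
    u₁⁻¹ ^ 3 + u₂⁻¹ ^ 3 + u₃⁻¹ ^ 3 ≤ l⁻¹ ^ 3 + 128 * l ^ 3 / (3 + l ^ 2) ^ 3 := by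
  set e₁ := u₁ + u₂ + u₃ with he₁
  set e₂ := u₁ * u₂ + u₂ * u₃ + u₃ * u₁ with he₂
  have he₂0 : 0 < e₂ := by positivity
  set t := (3 / l + l) / 4 with ht
  have ht0 : 0 < t := by positivity
  have hlt : l + 2 * t = e₁ := by rw [hs, ht]; field_simp; ring
  have hlt2 : 2 * l * t + t ^ 2 = e₂ := by rw [hp, hs, ht]; field_simp; ring
  have hle : l ≤ t := by
    rw [ht, le_div_iff₀ (by norm_num)]
    have : 3 ≤ 3 / l := by rw [le_div_iff₀ hl]; linarith
    linarith
  have hprod : l * t ^ 2 ≤ u₁ * u₂ * u₃ := by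
    have hu : l ≤ u₁ := by
      by_contra hlt'
      push Not at hlt'
      have hd : 0 ≤ (u₂ - u₃) ^ 2 := sq_nonneg _
      have e3 : u₂ + u₃ = l + 2 * t - u₁ := by linarith
      have e4 : u₂ * u₃ = 2 * l * t + t ^ 2 - u₁ * (l + 2 * t - u₁) := by
        rw [← e3]; linarith
      have e : (u₂ - u₃) ^ 2 = (u₁ - l) * (4 * t - l - 3 * u₁) := by
        calc (u₂ - u₃) ^ 2 = (u₂ + u₃) ^ 2 - 4 * (u₂ * u₃) := by ring
          _ = _ := by rw [e3, e4]; ring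
      have : (u₁ - l) * (4 * t - l - 3 * u₁) < 0 :=
        mul_neg_of_neg_of_pos (by linarith) (by linarith)
      linarith
    have e : u₁ * u₂ * u₃ - l * t ^ 2 = (u₁ - l) * (u₁ - t) ^ 2 := by
      have e3 : u₂ + u₃ = l + 2 * t - u₁ := by linarith
      have e4 : u₂ * u₃ = 2 * l * t + t ^ 2 - u₁ * (l + 2 * t - u₁) := by
        rw [← e3]; linarith
      rw [mul_assoc, e4]; ring
    nlinarith [mul_nonneg (sub_nonneg.2 hu) (sq_nonneg (u₁ - t))]
  have hR : l⁻¹ ^ 3 + 128 * l ^ 3 / (3 + l ^ 2) ^ 3 = l⁻¹ ^ 3 + t⁻¹ ^ 3 + t⁻¹ ^ 3 := by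
    have h4 : t = (3 + l ^ 2) / (4 * l) := by rw [ht]; field_simp
    rw [h4, inv_div]
    field_simp
    ring
  have hsym : 3 * e₁ * (u₁ * u₂ * u₃) ≤ e₂ ^ 2 := by
    nlinarith [sq_nonneg (u₁ * u₂ - u₂ * u₃), sq_nonneg (u₂ * u₃ - u₃ * u₁),
      sq_nonneg (u₃ * u₁ - u₁ * u₂)]
  rw [hR, sum_inv_cube_eq h₁.ne' h₂.ne' h₃.ne', sum_inv_cube_eq hl.ne' ht0.ne' ht0.ne',
    show l + t + t = e₁ by linarith, show l * t + t * t + t * l = e₂ by linarith,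
    show l * t * t = l * t ^ 2 by ring]
  have hp0 : 0 < u₁ * u₂ * u₃ := by positivity
  refine sum_inv_cube_mono he₂0 (inv_pos.2 hp0) (inv_anti₀ (by positivity) hprod) ?_
  rw [← div_eq_mul_inv, le_div_iff₀ hp0]
  exact hsym

lemma sum_inv_cube_sub_le {l : ℝ} (hl : 11 / 20 ≤ l) (hl1 : l ≤ 1) :
    l⁻¹ ^ 3 + 128 * l ^ 3 / (3 + l ^ 2) ^ 3 ≤ 3 + 33 / 5 * (3 / 2 * (l + 1 / l) - 3) := by
  have hl0 : 0 < l := by linarith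
  obtain ⟨x, rfl⟩ : ∃ x, l = 11 / 20 + x := ⟨l - 11 / 20, by ring⟩
  have hx : 0 ≤ x := by linarith
  have hR : 0 ≤ -27 - 54 * (11 / 20 + x) + 1593 / 10 * (11 / 20 + x) ^ 2 - 81 * (11 / 20 + x) ^ 3
      + 2043 / 10 * (11 / 20 + x) ^ 4 + 36 * (11 / 20 + x) ^ 5 + 951 / 10 * (11 / 20 + x) ^ 6
      + 3 * (11 / 20 + x) ^ 7 + 99 / 10 * (11 / 20 + x) ^ 8 := by
    ring_nf
    positivity
  generalize 11 / 20 + x = l at *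
  have e : 3 + 33 / 5 * (3 / 2 * (l + 1 / l) - 3) -
      (l⁻¹ ^ 3 + 128 * l ^ 3 / (3 + l ^ 2) ^ 3) =
      (1 - l) ^ 2 * (-27 - 54 * l + 1593 / 10 * l ^ 2 - 81 * l ^ 3 + 2043 / 10 * l ^ 4 + 36 * l ^ 5
        + 951 / 10 * l ^ 6 + 3 * l ^ 7 + 99 / 10 * l ^ 8) / (l ^ 3 * (3 + l ^ 2) ^ 3) := by
    field_simp
    ring
  have : 0 ≤ (1 - l) ^ 2 * (-27 - 54 * l + 1593 / 10 * l ^ 2 - 81 * l ^ 3 + 2043 / 10 * l ^ 4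
        + 36 * l ^ 5 + 951 / 10 * l ^ 6 + 3 * l ^ 7 + 99 / 10 * l ^ 8) /
        (l ^ 3 * (3 + l ^ 2) ^ 3) := by
    positivity
  linarith

lemma sum_inv_cube_le' {l : ℝ} (hl : 0 < l) (hl1 : l ≤ 1) :
    l⁻¹ ^ 3 + 128 * l ^ 3 / (3 + l ^ 2) ^ 3 ≤ l⁻¹ ^ 3 + 2 := by
  have : 128 * l ^ 3 / (3 + l ^ 2) ^ 3 ≤ 2 := by
    rw [div_le_iff₀ (by positivity)]
    have h : (4 * l) ^ 3 ≤ (3 + l ^ 2) ^ 3 := by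
      gcongr
      nlinarith
    nlinarith
  linarith

lemma le_inv_pow_six {u : ℝ} (hu : 0 < u) : 7 - 6 * u ≤ u⁻¹ ^ 6 := by
  have h := one_add_mul_le_pow (a := u⁻¹ - 1) (by have := inv_pos.2 hu; linarith) 6
  have h2 : 2 ≤ u + u⁻¹ := by
    have : u * u⁻¹ = 1 := mul_inv_cancel₀ hu.ne'
    nlinarith [sq_nonneg (u - u⁻¹), inv_pos.2 hu]
  push_cast at h
  rw [add_sub_cancel] at h
  linarith

/-! ### The first shell -/

/-- The polynomial certificate for the minorant of `q⁻⁶ - (1001/2560) q⁻³`. -/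
lemma minorant_attractive {q : ℝ} (hq : 0 < q) (hq1 : q ≤ 71 / 20) :
    1 / 64 - 1001 / 20480 + 55747 / 1024000 * (q - 2) - 7 / 1000 * (q ^ 2 - 4) ≤
      q⁻¹ ^ 6 - 1001 / 2560 * q⁻¹ ^ 3 := by
  have hR : 0 ≤ 1 / 4 + 1 / 4 * q + 3 / 16 * q ^ 2 + 279 / 10240 * q ^ 3 - 201 / 10240 * q ^ 4
      - 1083 / 40960 * q ^ 5 + 7 / 1000 * q ^ 6 := by
    rcases le_total q (71 / 40) with h | h
    · have t' : ∀ i j, 0 ≤ q ^ i * (71 / 40 - q) ^ j := fun i j => by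
        have : 0 ≤ 71 / 40 - q := by linarith
        positivity
      nlinarith [t' 0 6, t' 1 5, t' 2 4, t' 3 3, t' 4 2, t' 5 1, t' 6 0]
    · have t' : ∀ i j, 0 ≤ (q - 71 / 40) ^ i * (71 / 20 - q) ^ j := fun i j => by
        have : 0 ≤ 71 / 20 - q := by linarith
        have : 0 ≤ q - 71 / 40 := by linarith
        positivity
      nlinarith [t' 0 6, t' 1 5, t' 2 4, t' 3 3, t' 4 2, t' 5 1, t' 6 0]
  have e : q⁻¹ ^ 6 - 1001 / 2560 * q⁻¹ ^ 3 -
      (1 / 64 - 1001 / 20480 + 55747 / 1024000 * (q - 2) - 7 / 1000 * (q ^ 2 - 4)) =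
      (q - 2) ^ 2 * (1 / 4 + 1 / 4 * q + 3 / 16 * q ^ 2 + 279 / 10240 * q ^ 3
        - 201 / 10240 * q ^ 4 - 1083 / 40960 * q ^ 5 + 7 / 1000 * q ^ 6) / q ^ 6 := by
    field_simp; ring
  have : 0 ≤ (q - 2) ^ 2 * (1 / 4 + 1 / 4 * q + 3 / 16 * q ^ 2 + 279 / 10240 * q ^ 3
        - 201 / 10240 * q ^ 4 - 1083 / 40960 * q ^ 5 + 7 / 1000 * q ^ 6) / q ^ 6 := by
    positivity
  linarith

lemma minorant_repulsive {q : ℝ} (hq : 0 < q) (hq1 : q ≤ 71 / 20) :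
    1 / 64 - 227 / 1600 * (q - 2) + 19 / 800 * (q ^ 2 - 4) ≤ q⁻¹ ^ 6 := by
  have hR : 0 ≤ 1 / 4 + 1 / 4 * q + 3 / 16 * q ^ 2 + 1 / 8 * q ^ 3 + 5 / 64 * q ^ 4
      + 3 / 64 * q ^ 5 - 19 / 800 * q ^ 6 := by
    have t : ∀ i j, 0 ≤ q ^ i * (71 / 20 - q) ^ j := fun i j => by
      have : 0 ≤ 71 / 20 - q := by linarith
      positivity
    nlinarith [t 0 6, t 1 5, t 2 4, t 3 3, t 4 2, t 5 1, t 6 0]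
  have e : q⁻¹ ^ 6 - (1 / 64 - 227 / 1600 * (q - 2) + 19 / 800 * (q ^ 2 - 4)) =
      (q - 2) ^ 2 * (1 / 4 + 1 / 4 * q + 3 / 16 * q ^ 2 + 1 / 8 * q ^ 3 + 5 / 64 * q ^ 4
      + 3 / 64 * q ^ 5 - 19 / 800 * q ^ 6) / q ^ 6 := by
    field_simp; ring
  have : 0 ≤ (q - 2) ^ 2 * (1 / 4 + 1 / 4 * q + 3 / 16 * q ^ 2 + 1 / 8 * q ^ 3 + 5 / 64 * q ^ 4
      + 3 / 64 * q ^ 5 - 19 / 800 * q ^ 6) / q ^ 6 := by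
    positivity
  linarith

/-! ### Positive definite binary forms in Selling coordinates -/

/-- The binary form `α m² + β n² + γ (m + n)²`. -/
def sellingForm (α β γ : ℝ) (v : ℤ × ℤ) : ℝ :=
  α * v.1 ^ 2 + β * v.2 ^ 2 + γ * (v.1 + v.2) ^ 2

/-- The Epstein sum `∑ f(v)⁻ᵏ` of the form `f` with Selling coordinates `α`, `β`, `γ`
(the zero vector contributes `0⁻¹ = 0`). -/
noncomputable def sellingSum (k : ℕ) (α β γ : ℝ) : ℝ := ∑' v, (sellingForm α β γ v)⁻¹ ^ k

/-- The automorphism of order three (up to sign) of the hexagonal form. -/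
def hexagonalRotation : ℤ × ℤ ≃ ℤ × ℤ where
  toFun v := (v.2, -(v.1 + v.2))
  invFun v := (-(v.1 + v.2), v.1)
  left_inv v := by ext <;> simp
  right_inv v := by ext <;> simp

lemma sellingForm_rotation (α β γ : ℝ) (v : ℤ × ℤ) :
    sellingForm α β γ (hexagonalRotation v) = sellingForm γ α β v := by
  simp only [sellingForm, hexagonalRotation, Equiv.coe_fn_mk]
  push_cast
  ring

lemma sellingForm_one (v : ℤ × ℤ) : sellingForm 1 1 1 v = 2 * eisNorm v := by
  simp only [sellingForm, eisNorm]
  push_cast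
  ring

lemma sellingSum_rotation (k : ℕ) (α β γ : ℝ) : sellingSum k γ α β = sellingSum k α β γ := by
  unfold sellingSum
  rw [← hexagonalRotation.tsum_eq fun v => (sellingForm α β γ v)⁻¹ ^ k]
  simp_rw [sellingForm_rotation]

lemma three_mul_eisNorm_le {α β γ : ℝ} (h : α * β + β * γ + γ * α = 3) (v : ℤ × ℤ) :
    3 * (eisNorm v : ℝ) ≤ (α + β + γ) * sellingForm α β γ v := by
  obtain ⟨m, n⟩ := v
  simp only [sellingForm, eisNorm]
  push_cast
  rw [← h]
  nlinarith [sq_nonneg (α * m - β * n), sq_nonneg (β * n + γ * (m + n)),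
    sq_nonneg (γ * (m + n) + α * m)]

lemma sum_ge_three {α β γ : ℝ} (hα : 0 ≤ α) (hβ : 0 ≤ β) (hγ : 0 ≤ γ)
    (h : α * β + β * γ + γ * α = 3) : 3 ≤ α + β + γ := by
  nlinarith [sq_nonneg (α - β), sq_nonneg (β - γ), sq_nonneg (γ - α)]

lemma eisNorm_pos {v : ℤ × ℤ} (hv : v ≠ 0) : 0 < (eisNorm v : ℝ) := by
  have h1 := eisNorm_nonneg v
  have h2 : eisNorm v ≠ 0 := fun h => hv (eisNorm_eq_zero h)
  exact_mod_cast lt_of_le_of_ne h1 h2.symm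

lemma sellingForm_pos {α β γ : ℝ} (hα : 0 ≤ α) (hβ : 0 ≤ β) (hγ : 0 ≤ γ)
    (h : α * β + β * γ + γ * α = 3) {v : ℤ × ℤ} (hv : v ≠ 0) : 0 < sellingForm α β γ v := by
  have h3 := sum_ge_three hα hβ hγ h
  have h1 := three_mul_eisNorm_le h v
  have h2 := eisNorm_pos hv
  by_contra hn
  push Not at hn
  nlinarith

lemma sellingForm_zero (α β γ : ℝ) : sellingForm α β γ 0 = 0 := by
  simp [sellingForm]

lemma one_le_eisNorm {v : ℤ × ℤ} (hv : v ≠ 0) : 1 ≤ (eisNorm v : ℝ) := by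
  have h2 := eisNorm_pos hv
  have : 0 < eisNorm v := by exact_mod_cast h2
  exact_mod_cast this

lemma summable_inv_eisNorm_pow {k : ℕ} (hk : 3 ≤ k) :
    Summable fun v => (eisNorm v : ℝ)⁻¹ ^ k := by
  have h1 := (hasSum_ite_mem_const hexagon 1).summable
  have h2 := (hasSum_ite_mem_const doubleHexagon 1).summable
  refine Summable.of_nonneg_of_le (fun v => ?_) (fun v => ?_)
    ((h1.add h2).add summable_outerWeight)
  · have := eisNorm_nonneg v
    have : 0 ≤ (eisNorm v : ℝ) := by exact_mod_cast this
    positivity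
  · have hw : (0 : ℝ) ≤ outerWeight v := Rat.cast_nonneg.2 (outerWeight_nonneg v)
    rcases eq_or_ne v 0 with rfl | hv
    · have : eisNorm 0 = 0 := rfl
      rw [this]
      simp only [Int.cast_zero, inv_zero, zero_pow (by omega : k ≠ 0)]
      split_ifs <;> positivity
    have he := one_le_eisNorm hv
    have hle : (eisNorm v : ℝ)⁻¹ ^ k ≤ (eisNorm v : ℝ)⁻¹ ^ 3 :=
      pow_le_pow_of_le_one (by positivity) (inv_le_one_of_one_le₀ he) hk
    have hle1 : (eisNorm v : ℝ)⁻¹ ^ 3 ≤ 1 :=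
      pow_le_one₀ (by positivity) (inv_le_one_of_one_le₀ he)
    by_cases hA : v ∈ hexagon
    · rw [if_pos hA]
      split_ifs <;> linarith
    by_cases hB : v ∈ doubleHexagon
    · rw [if_neg hA, if_pos hB]
      linarith
    rw [if_neg hA, if_neg hB, zero_add, zero_add, outerWeight, if_neg]
    · push_cast
      rwa [one_div, ← inv_pow]
    · rintro (h | h | h)
      · exact hv (eisNorm_eq_zero h)
      · exact hA (mem_hexagon_of_eisNorm h)
      · exact hB (mem_doubleHexagon_of_eisNorm h)

lemma summable_inv_sellingForm_pow {α β γ : ℝ} (hα : 0 ≤ α) (hβ : 0 ≤ β) (hγ : 0 ≤ γ)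
    (h : α * β + β * γ + γ * α = 3) {k : ℕ} (hk : 3 ≤ k) :
    Summable fun v => (sellingForm α β γ v)⁻¹ ^ k := by
  refine Summable.of_nonneg_of_le (fun v => ?_) (fun v => ?_)
    ((summable_inv_eisNorm_pow hk).mul_left (((α + β + γ) / 3) ^ k))
  · unfold sellingForm
    positivity
  · rcases eq_or_ne v 0 with rfl | hv
    · have : eisNorm 0 = 0 := rfl
      simp [sellingForm_zero, this, zero_pow (by omega : k ≠ 0)]
    have hq := sellingForm_pos hα hβ hγ h hv
    have he := eisNorm_pos hv
    have := three_mul_eisNorm_le h v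
    rw [← mul_pow]
    gcongr
    rw [← div_eq_mul_inv, inv_eq_one_div, div_div, div_le_div_iff₀ hq (by positivity)]
    linarith

/-- The sum over the cyclic permutations of `α`, `β`, `γ` of the terms at `v` of the Epstein
sums, minus the corresponding terms of the hexagonal form. -/
noncomputable def cyclicExcess (k : ℕ) (α β γ : ℝ) (v : ℤ × ℤ) : ℝ :=
  (sellingForm α β γ v)⁻¹ ^ k + (sellingForm γ α β v)⁻¹ ^ k + (sellingForm β γ α v)⁻¹ ^ k -
    3 * (sellingForm 1 1 1 v)⁻¹ ^ k

lemma hasSum_cyclicExcess {α β γ : ℝ} (hα : 0 ≤ α) (hβ : 0 ≤ β) (hγ : 0 ≤ γ)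
    (h : α * β + β * γ + γ * α = 3) {k : ℕ} (hk : 3 ≤ k) :
    HasSum (cyclicExcess k α β γ) (3 * (sellingSum k α β γ - sellingSum k 1 1 1)) := by
  have h1 := (summable_inv_sellingForm_pow hα hβ hγ h hk).hasSum
  have h2 := (summable_inv_sellingForm_pow hγ hα hβ (by linarith) hk).hasSum
  have h3 := (summable_inv_sellingForm_pow hβ hγ hα (by linarith) hk).hasSum
  have h4 := (summable_inv_sellingForm_pow zero_le_one zero_le_one zero_le_one
    (by norm_num) hk).hasSum
  have e : 3 * (sellingSum k α β γ - sellingSum k 1 1 1) =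
      sellingSum k α β γ + sellingSum k γ α β + sellingSum k β γ α - 3 * sellingSum k 1 1 1 := by
    rw [sellingSum_rotation k α β γ, ← sellingSum_rotation k β γ α]
    ring
  rw [e]
  exact ((h1.add h2).add h3).sub (h4.mul_left 3)

/-- Lower bounds for the terms in the inner two shells and in the outer shells give a lower
bound for the difference of Epstein sums. -/
lemma le_sellingSum_sub {α β γ τ c₁ c₄ c : ℝ} (hα : 0 ≤ α) (hβ : 0 ≤ β) (hγ : 0 ≤ γ)
    (h : α * β + β * γ + γ * α = 3) (hc : 0 ≤ c)
    (h₁ : ∀ v, eisNorm v = 1 → c₁ ≤ cyclicExcess 6 α β γ v - τ * cyclicExcess 3 α β γ v)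
    (h₄ : ∀ v, eisNorm v = 4 → c₄ ≤ cyclicExcess 6 α β γ v - τ * cyclicExcess 3 α β γ v)
    (h₀ : ∀ v, eisNorm v ≠ 0 → eisNorm v ≠ 1 → eisNorm v ≠ 4 →
      -(c * ((eisNorm v : ℝ)⁻¹ ^ 3)) ≤ cyclicExcess 6 α β γ v - τ * cyclicExcess 3 α β γ v) :
    6 * c₁ + 6 * c₄ - 29 / 100 * c ≤
      3 * ((sellingSum 6 α β γ - sellingSum 6 1 1 1) -
        τ * (sellingSum 3 α β γ - sellingSum 3 1 1 1)) := by
  have hS := (hasSum_cyclicExcess hα hβ hγ h (k := 6) (by norm_num)).sub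
    ((hasSum_cyclicExcess hα hβ hγ h (k := 3) le_rfl).mul_left τ)
  have hG := ((hasSum_ite_mem_const hexagon c₁).add (hasSum_ite_mem_const doubleHexagon c₄)).sub
    (summable_outerWeight.hasSum.mul_left c)
  have hle := hasSum_le (fun v => ?_) hG hS
  · have hw := mul_le_mul_of_nonneg_left tsum_outerWeight_le hc
    have e₁ : hexagon.card = 6 := rfl
    have e₄ : doubleHexagon.card = 6 := rfl
    rw [e₁, e₄] at hle
    push_cast at hle
    linarith
  · by_cases hA : v ∈ hexagon
    · have he := eisNorm_of_mem_hexagon v hA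
      have hB : v ∉ doubleHexagon := fun hB => by
        have := eisNorm_of_mem_doubleHexagon v hB
        omega
      have hw : outerWeight v = 0 := by simp [outerWeight, he]
      simpa [hA, hB, hw] using h₁ v he
    by_cases hB : v ∈ doubleHexagon
    · have he := eisNorm_of_mem_doubleHexagon v hB
      have hw : outerWeight v = 0 := by simp [outerWeight, he]
      simpa [hA, hB, hw] using h₄ v he
    rcases eq_or_ne v 0 with rfl | hv
    · have hw : outerWeight 0 = 0 := rfl
      simp [hA, hB, hw, cyclicExcess, sellingForm_zero]
    have n1 : eisNorm v ≠ 1 := fun h => hA (mem_hexagon_of_eisNorm h)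
    have n4 : eisNorm v ≠ 4 := fun h => hB (mem_doubleHexagon_of_eisNorm h)
    have n0 : eisNorm v ≠ 0 := fun h => hv (eisNorm_eq_zero h)
    have := h₀ v n0 n1 n4
    have hw : (outerWeight v : ℝ) = (eisNorm v : ℝ)⁻¹ ^ 3 := by
      simp [outerWeight, n0, n1, n4]
    simp only [hA, hB, if_false, hw]
    linarith

/-- The three values at `v` of the cyclically permuted forms, divided by the value of the
hexagonal form, have prescribed sum and sum of pairwise products. -/
lemma exists_cyclicExcess_eq {α β γ : ℝ} (hα : 0 ≤ α) (hβ : 0 ≤ β) (hγ : 0 ≤ γ)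
    (h : α * β + β * γ + γ * α = 3) {v : ℤ × ℤ} (hv : eisNorm v ≠ 0) :
    ∃ u₁ u₂ u₃ : ℝ, 0 < u₁ ∧ 0 < u₂ ∧ 0 < u₃ ∧ u₁ + u₂ + u₃ = α + β + γ ∧
      u₁ * u₂ + u₂ * u₃ + u₃ * u₁ = ((u₁ + u₂ + u₃) ^ 2 + 3) / 4 ∧
      ∀ k, cyclicExcess k α β γ v =
        (2 * (eisNorm v : ℝ))⁻¹ ^ k * (u₁⁻¹ ^ k + u₂⁻¹ ^ k + u₃⁻¹ ^ k - 3) := by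
  have hv0 : v ≠ 0 := by rintro rfl; exact hv rfl
  have he := eisNorm_pos hv0
  have q1 := sellingForm_pos hα hβ hγ h hv0
  have q2 := sellingForm_pos hγ hα hβ (by linarith) hv0
  have q3 := sellingForm_pos hβ hγ hα (by linarith) hv0
  have hs : sellingForm α β γ v + sellingForm γ α β v + sellingForm β γ α v =
      (α + β + γ) * (2 * eisNorm v) := by
    simp only [sellingForm, eisNorm]; push_cast; ring
  have hs' : sellingForm α β γ v / (2 * eisNorm v) + sellingForm γ α β v / (2 * eisNorm v) +
      sellingForm β γ α v / (2 * eisNorm v) = α + β + γ := by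
    rw [← add_div, ← add_div, hs, mul_div_cancel_right₀ _ (by positivity)]
  refine ⟨sellingForm α β γ v / (2 * eisNorm v), sellingForm γ α β v / (2 * eisNorm v),
    sellingForm β γ α v / (2 * eisNorm v), by positivity, by positivity, by positivity,
    hs', ?_, ?_⟩
  · have hp : sellingForm α β γ v * sellingForm γ α β v +
        sellingForm γ α β v * sellingForm β γ α v + sellingForm β γ α v * sellingForm α β γ v =
        (2 * eisNorm v) ^ 2 * (((α + β + γ) ^ 2 + 3) / 4) := by
      rw [← h]
      simp only [sellingForm, eisNorm]; push_cast; ring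
    rw [hs', div_mul_div_comm, div_mul_div_comm, div_mul_div_comm, ← add_div, ← add_div, hp,
      ← sq, mul_div_cancel_left₀ _ (by positivity)]
  · intro k
    simp only [cyclicExcess, sellingForm_one, inv_div, div_pow, inv_pow]
    field_simp

/-! ### Termwise bounds -/

/-- The common value of `cyclicExcess k α β γ` on the six vectors of the first shell. -/
noncomputable def shellExcess (k : ℕ) (α β γ : ℝ) : ℝ :=
  (β + γ)⁻¹ ^ k + (γ + α)⁻¹ ^ k + (α + β)⁻¹ ^ k - 3 * 2⁻¹ ^ k

lemma cyclicExcess_of_eisNorm_eq_one (k : ℕ) (α β γ : ℝ) {v : ℤ × ℤ} (hv : eisNorm v = 1) :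
    cyclicExcess k α β γ v = shellExcess k α β γ := by
  have := mem_hexagon_of_eisNorm hv
  simp only [hexagon, Finset.mem_insert, Finset.mem_singleton] at this
  rcases this with rfl | rfl | rfl | rfl | rfl | rfl <;>
    simp only [cyclicExcess, sellingForm, shellExcess] <;> norm_num <;> ring

lemma cyclicExcess_of_eisNorm_eq_four (k : ℕ) (α β γ : ℝ) {v : ℤ × ℤ} (hv : eisNorm v = 4) :
    cyclicExcess k α β γ v = 4⁻¹ ^ k * shellExcess k α β γ := by
  have key : ∀ w : ℤ × ℤ, eisNorm w = 1 → v = (2 * w.1, 2 * w.2) →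
      cyclicExcess k α β γ v = 4⁻¹ ^ k * shellExcess k α β γ := by
    intro w hw hvw
    have hq : ∀ a b c : ℝ, sellingForm a b c v = 4 * sellingForm a b c w := fun a b c => by
      rw [hvw]; simp only [sellingForm]; push_cast; ring
    rw [← cyclicExcess_of_eisNorm_eq_one k α β γ hw]
    simp only [cyclicExcess, hq, mul_inv, mul_pow]
    ring
  have := mem_doubleHexagon_of_eisNorm hv
  simp only [doubleHexagon, Finset.mem_insert, Finset.mem_singleton] at this
  rcases this with rfl | rfl | rfl | rfl | rfl | rfl
  · exact key (1, 0) rfl rfl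
  · exact key (-1, 0) rfl rfl
  · exact key (0, 1) rfl rfl
  · exact key (0, -1) rfl rfl
  · exact key (1, -1) rfl rfl
  · exact key (-1, 1) rfl rfl

lemma neg_le_cyclicExcess_six {α β γ : ℝ} (hα : 0 ≤ α) (hβ : 0 ≤ β) (hγ : 0 ≤ γ)
    (h : α * β + β * γ + γ * α = 3) {v : ℤ × ℤ} (hv : eisNorm v ≠ 0) :
    -(6 * (α + β + γ - 3) * (2 * (eisNorm v : ℝ))⁻¹ ^ 6) ≤ cyclicExcess 6 α β γ v := by
  obtain ⟨u₁, u₂, u₃, h₁, h₂, h₃, hs, -, hk⟩ := exists_cyclicExcess_eq hα hβ hγ h hv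
  rw [hk 6]
  have b := le_inv_pow_six h₁
  have b' := le_inv_pow_six h₂
  have b'' := le_inv_pow_six h₃
  have hp : 0 ≤ (2 * (eisNorm v : ℝ))⁻¹ ^ 6 := by positivity
  nlinarith [mul_le_mul_of_nonneg_left
    (show -(6 * (α + β + γ - 3)) ≤ u₁⁻¹ ^ 6 + u₂⁻¹ ^ 6 + u₃⁻¹ ^ 6 - 3 by linarith) hp]

lemma neg_three_le_cyclicExcess_six (α β γ : ℝ) (v : ℤ × ℤ) :
    -(3 * (2 * (eisNorm v : ℝ))⁻¹ ^ 6) ≤ cyclicExcess 6 α β γ v := by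
  unfold cyclicExcess
  rw [sellingForm_one]
  have : 0 ≤ (sellingForm α β γ v)⁻¹ ^ 6 := by positivity
  have : 0 ≤ (sellingForm γ α β v)⁻¹ ^ 6 := by positivity
  have : 0 ≤ (sellingForm β γ α v)⁻¹ ^ 6 := by positivity
  linarith

lemma cyclicExcess_three_le {α β γ l : ℝ} (hα : 0 ≤ α) (hβ : 0 ≤ β) (hγ : 0 ≤ γ)
    (h : α * β + β * γ + γ * α = 3) (hl : 0 < l) (hl1 : l ≤ 1)
    (hσ : α + β + γ = 3 / 2 * (l + 1 / l)) {v : ℤ × ℤ} (hv : eisNorm v ≠ 0) :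
    cyclicExcess 3 α β γ v ≤
      (2 * (eisNorm v : ℝ))⁻¹ ^ 3 * (l⁻¹ ^ 3 + 128 * l ^ 3 / (3 + l ^ 2) ^ 3 - 3) := by
  obtain ⟨u₁, u₂, u₃, h₁, h₂, h₃, hs, hp, hk⟩ := exists_cyclicExcess_eq hα hβ hγ h hv
  rw [hk 3]
  have he : 0 < (eisNorm v : ℝ) := eisNorm_pos (by rintro rfl; exact hv rfl)
  have := sum_inv_cube_le hl hl1 h₁ h₂ h₃ (hs.trans hσ) hp
  gcongr

lemma inv_two_mul_pow_six_le {e : ℝ} (he : 2 ≤ e) :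
    (2 * e)⁻¹ ^ 6 ≤ 1 / 512 * e⁻¹ ^ 3 := by
  have h1 : e⁻¹ ≤ 2⁻¹ := inv_anti₀ (by norm_num) he
  have h0 : 0 < e⁻¹ := by positivity
  have h3 : e⁻¹ ^ 3 ≤ 2⁻¹ ^ 3 := by gcongr
  have := mul_le_mul_of_nonneg_left h3 (show 0 ≤ e⁻¹ ^ 3 by positivity)
  rw [mul_inv, mul_pow]
  nlinarith

lemma two_le_eisNorm {v : ℤ × ℤ} (h0 : eisNorm v ≠ 0) (h1 : eisNorm v ≠ 1) :
    2 ≤ (eisNorm v : ℝ) := by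
  have := eisNorm_nonneg v
  exact_mod_cast (by omega : 2 ≤ eisNorm v)

lemma add_pos_of_form {α β γ : ℝ} (hβ : 0 ≤ β) (hγ : 0 ≤ γ)
    (h : α * β + β * γ + γ * α = 3) : 0 < β + γ := by
  by_contra hn
  have h1 : β = 0 := by linarith
  have h2 : γ = 0 := by linarith
  simp [h1, h2] at h

/-! ### Forms close to the hexagonal one -/

lemma lower_bound_near {α β γ τ : ℝ} (hα : 0 ≤ α) (hβ : 0 ≤ β) (hγ : 0 ≤ γ)
    (h : α * β + β * γ + γ * α = 3) (hσ : α + β + γ ≤ 71 / 20) (hτ : 0 ≤ τ) :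
    6 * (shellExcess 6 α β γ - 65 / 64 * τ * shellExcess 3 α β γ) -
        (α + β + γ - 3) * (36 / 8 ^ 6 + 29 / 100 * (6 / 512 + 33 / 40 * τ)) ≤
      3 * ((sellingSum 6 α β γ - sellingSum 6 1 1 1) -
        τ * (sellingSum 3 α β γ - sellingSum 3 1 1 1)) := by
  have hσ3 := sum_ge_three hα hβ hγ h
  obtain ⟨l, hl0, hl1, hl⟩ := exists_scale hσ3
  have hl' : 11 / 20 ≤ l := by
    by_contra hn
    push Not at hn
    rw [hl] at hσ
    have : l * (1 / l) = 1 := mul_one_div_cancel hl0.ne'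
    nlinarith
  refine le_trans (le_of_eq ?_) (le_sellingSum_sub (τ := τ)
    (c₁ := shellExcess 6 α β γ - τ * shellExcess 3 α β γ)
    (c₄ := -(6 * (α + β + γ - 3) / 8 ^ 6) - τ * (1 / 64 * shellExcess 3 α β γ))
    (c := (α + β + γ - 3) * (6 / 512 + 33 / 40 * τ)) hα hβ hγ h
    (mul_nonneg (by linarith) (by positivity)) ?_ ?_ ?_)
  · ring
  · intro v hv
    rw [cyclicExcess_of_eisNorm_eq_one _ _ _ _ hv, cyclicExcess_of_eisNorm_eq_one _ _ _ _ hv]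
  · intro v hv
    have h6 := neg_le_cyclicExcess_six hα hβ hγ h (v := v) (by omega)
    rw [cyclicExcess_of_eisNorm_eq_four 3 _ _ _ hv]
    rw [hv] at h6
    norm_num at h6 ⊢
    linarith
  · intro v h0 h1 h4
    have he := two_le_eisNorm h0 h1
    have h6 := neg_le_cyclicExcess_six hα hβ hγ h h0
    have h3 := cyclicExcess_three_le hα hβ hγ h hl0 hl1 hl h0
    have hs := sum_inv_cube_sub_le hl' hl1
    rw [← hl] at hs
    have hp := mul_le_mul_of_nonneg_left (inv_two_mul_pow_six_le he)
      (show 0 ≤ 6 * (α + β + γ - 3) by linarith)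
    have h3' : cyclicExcess 3 α β γ v ≤
        (2 * (eisNorm v : ℝ))⁻¹ ^ 3 * (33 / 5 * (α + β + γ - 3)) := by
      refine h3.trans ?_
      gcongr
      linarith
    rw [mul_inv, mul_pow] at h3'
    have := mul_le_mul_of_nonneg_left h3' hτ
    nlinarith

lemma pos_near {α β γ : ℝ} (hα : 0 ≤ α) (hβ : 0 ≤ β) (hγ : 0 ≤ γ)
    (h : α * β + β * γ + γ * α = 3) (hσ3 : 3 < α + β + γ) (hσ : α + β + γ ≤ 71 / 20) :
    0 < sellingSum 6 α β γ - sellingSum 6 1 1 1 ∧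
      0 < (sellingSum 6 α β γ - sellingSum 6 1 1 1) -
        77 / 200 * (sellingSum 3 α β γ - sellingSum 3 1 1 1) := by
  have q₁ := add_pos_of_form hβ hγ h
  have q₂ := add_pos_of_form hγ hα (by linarith : β * γ + γ * α + α * β = 3)
  have q₃ := add_pos_of_form hα hβ (by linarith : γ * α + α * β + β * γ = 3)
  have hsq : (β + γ) ^ 2 + (γ + α) ^ 2 + (α + β) ^ 2 = 2 * (α + β + γ) ^ 2 - 6 := by
    linear_combination -2 * h
  generalize hE : α + β + γ - 3 = E
  have hE0 : 0 < E := by linarith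
  have hσE : α + β + γ = E + 3 := by linarith
  rw [hσE] at hsq
  constructor
  · have hb := lower_bound_near hα hβ hγ h hσ le_rfl
    have m₁ := minorant_repulsive q₁ (by linarith)
    have m₂ := minorant_repulsive q₂ (by linarith)
    have m₃ := minorant_repulsive q₃ (by linarith)
    rw [hE] at hb
    have hA : 1 / 800 * E ≤ shellExcess 6 α β γ := by
      unfold shellExcess
      nlinarith
    nlinarith
  · have hb := lower_bound_near hα hβ hγ h hσ (τ := 77 / 200) (by norm_num)
    have m₁ := minorant_attractive q₁ (by linarith)
    have m₂ := minorant_attractive q₂ (by linarith)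
    have m₃ := minorant_attractive q₃ (by linarith)
    rw [hE] at hb
    have hA : 17 / 1000 * E ≤ shellExcess 6 α β γ - 1001 / 2560 * shellExcess 3 α β γ := by
      unfold shellExcess
      nlinarith
    nlinarith

/-! ### Forms far from the hexagonal one -/

lemma lower_bound_far {α β γ τ y : ℝ} (hα : 0 ≤ α) (hβ : 0 ≤ β) (hγ : 0 ≤ γ)
    (h : α * β + β * γ + γ * α = 3) (hτ : 0 ≤ τ) {l : ℝ} (hl0 : 0 < l) (hl1 : l ≤ 1)
    (hl : α + β + γ = 3 / 2 * (l + 1 / l)) (hy : l⁻¹ ^ 3 ≤ y) :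
    6 * (shellExcess 6 α β γ - 65 / 64 * τ * shellExcess 3 α β γ - 3 / 8 ^ 6) -
        29 / 100 * (3 / 512 + τ / 8 * (y - 1)) ≤
      3 * ((sellingSum 6 α β γ - sellingSum 6 1 1 1) -
        τ * (sellingSum 3 α β γ - sellingSum 3 1 1 1)) := by
  have hy1 : 1 ≤ y := le_trans (one_le_pow₀ ((one_le_inv₀ hl0).2 hl1)) hy
  refine le_trans (le_of_eq ?_) (le_sellingSum_sub (τ := τ)
    (c₁ := shellExcess 6 α β γ - τ * shellExcess 3 α β γ)
    (c₄ := -(3 / 8 ^ 6) - τ * (1 / 64 * shellExcess 3 α β γ))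
    (c := 3 / 512 + τ / 8 * (y - 1)) hα hβ hγ h
    (add_nonneg (by norm_num) (mul_nonneg (by positivity) (by linarith))) ?_ ?_ ?_)
  · ring
  · intro v hv
    rw [cyclicExcess_of_eisNorm_eq_one _ _ _ _ hv, cyclicExcess_of_eisNorm_eq_one _ _ _ _ hv]
  · intro v hv
    have h6 := neg_three_le_cyclicExcess_six α β γ v
    rw [cyclicExcess_of_eisNorm_eq_four 3 _ _ _ hv]
    rw [hv] at h6
    norm_num at h6 ⊢
    linarith
  · intro v h0 h1 h4
    have he := two_le_eisNorm h0 h1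
    have h6 := neg_three_le_cyclicExcess_six α β γ v
    have h3 := cyclicExcess_three_le hα hβ hγ h hl0 hl1 hl h0
    have hs := sum_inv_cube_le' hl0 hl1
    have hp := inv_two_mul_pow_six_le he
    have h3' : cyclicExcess 3 α β γ v ≤ (2 * (eisNorm v : ℝ))⁻¹ ^ 3 * (y - 1) := by
      exact h3.trans (mul_le_mul_of_nonneg_left (by linarith) (by positivity))
    rw [mul_inv, mul_pow] at h3'
    have := mul_le_mul_of_nonneg_left h3' hτ
    nlinarith

lemma pos_far_of_max {α β γ : ℝ} (hα : 0 ≤ α) (hβ : 0 ≤ β) (hγ : 0 ≤ γ)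
    (h : α * β + β * γ + γ * α = 3) (hσ : 71 / 20 ≤ α + β + γ) (hαβ : β ≤ α) (hαγ : γ ≤ α) :
    0 < sellingSum 6 α β γ - sellingSum 6 1 1 1 ∧
      0 < (sellingSum 6 α β γ - sellingSum 6 1 1 1) -
        77 / 200 * (sellingSum 3 α β γ - sellingSum 3 1 1 1) := by
  have q₁ := add_pos_of_form hβ hγ h
  have q₂ := add_pos_of_form hγ hα (by linarith : β * γ + γ * α + α * β = 3)
  have q₃ := add_pos_of_form hα hβ (by linarith : γ * α + α * β + β * γ = 3)
  have hhalf : β + γ ≤ α := by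
    by_contra hn
    push Not at hn
    nlinarith [mul_nonneg (show 0 ≤ β + γ - α by linarith) (show 0 ≤ α + β - γ by linarith),
      mul_nonneg (show 0 ≤ β + γ - α by linarith) (show 0 ≤ α + γ - β by linarith),
      mul_nonneg (show 0 ≤ α + γ - β by linarith) (show 0 ≤ α + β - γ by linarith)]
  have hq3 : (β + γ) * α ≤ 3 := by nlinarith [mul_nonneg hβ hγ]
  have hq : β + γ ≤ 1387 / 1000 := by
    by_contra hn
    push Not at hn
    nlinarith
  obtain ⟨l, hl0, hl1, hl⟩ := exists_scale (show 3 ≤ α + β + γ by linarith)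
  have hll : l * (1 / l) = 1 := mul_one_div_cancel hl0.ne'
  have hlq : 79 / 200 * (β + γ) ≤ l := by
    by_contra hn
    push Not at hn
    have hi : 1 ≤ 1 / l := one_le_one_div hl0 hl1
    have h1 := mul_pos (sub_pos.2 hn) (show 0 < 1 / l - 79 / 200 * (β + γ) by linarith)
    have h2 : 0 < 79 / 200 * (β + γ) * (2 / 3 * (α + (β + γ))) - (79 / 200 * (β + γ)) ^ 2 - 1 := by
      rw [show α + (β + γ) = 3 / 2 * (l + 1 / l) by linarith]
      linarith
    nlinarith
  set x := (β + γ)⁻¹ ^ 3 with hx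
  have hy : l⁻¹ ^ 3 ≤ 8000000 / 493039 * x := by
    have : l⁻¹ ≤ 200 / 79 * (β + γ)⁻¹ := by
      rw [show 200 / 79 * (β + γ)⁻¹ = (79 / 200 * (β + γ))⁻¹ by rw [mul_inv]; norm_num]
      exact inv_anti₀ (by positivity) hlq
    calc l⁻¹ ^ 3 ≤ (200 / 79 * (β + γ)⁻¹) ^ 3 := by gcongr
      _ = _ := by rw [hx]; ring
  have hx1 : 3747 / 10000 ≤ x := by
    have : (1387 / 1000)⁻¹ ≤ (β + γ)⁻¹ := inv_anti₀ q₁ hq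
    have : (1387 / 1000 : ℝ)⁻¹ ^ 3 ≤ (β + γ)⁻¹ ^ 3 := by gcongr
    refine le_trans ?_ this
    norm_num
  have hx6 : (β + γ)⁻¹ ^ 6 = x ^ 2 := by rw [hx]; ring
  have b₂ : (γ + α)⁻¹ ^ 6 = ((γ + α)⁻¹ ^ 3) ^ 2 := by ring
  have b₃ : (α + β)⁻¹ ^ 6 = ((α + β)⁻¹ ^ 3) ^ 2 := by ring
  constructor
  · have hb := lower_bound_far hα hβ hγ h le_rfl hl0 hl1 hl hy
    rw [shellExcess, hx6, b₂, b₃] at hb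
    nlinarith
  · have hb := lower_bound_far hα hβ hγ h (τ := 77 / 200) (by norm_num) hl0 hl1 hl hy
    rw [shellExcess, shellExcess, hx6, b₂, b₃, ← hx] at hb
    nlinarith [sq_nonneg ((γ + α)⁻¹ ^ 3 - 1001 / 5120), sq_nonneg ((α + β)⁻¹ ^ 3 - 1001 / 5120)]

lemma pos_of_three_lt {α β γ : ℝ} (hα : 0 ≤ α) (hβ : 0 ≤ β) (hγ : 0 ≤ γ)
    (h : α * β + β * γ + γ * α = 3) (hσ3 : 3 < α + β + γ) :
    0 < sellingSum 6 α β γ - sellingSum 6 1 1 1 ∧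
      0 < (sellingSum 6 α β γ - sellingSum 6 1 1 1) -
        77 / 200 * (sellingSum 3 α β γ - sellingSum 3 1 1 1) := by
  rcases le_total (α + β + γ) (71 / 20) with hσ | hσ
  · exact pos_near hα hβ hγ h hσ3 hσ
  by_cases h1 : β ≤ α ∧ γ ≤ α
  · exact pos_far_of_max hα hβ hγ h hσ h1.1 h1.2
  by_cases h2 : α ≤ γ ∧ β ≤ γ
  · rw [← sellingSum_rotation 6 α β γ, ← sellingSum_rotation 3 α β γ]
    exact pos_far_of_max hγ hα hβ (by linarith) (by linarith) h2.1 h2.2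
  · rw [sellingSum_rotation 6 β γ α, sellingSum_rotation 3 β γ α]
    refine pos_far_of_max hβ hγ hα (by linarith) (by linarith) ?_ ?_ <;> grind

/-- The form with equal Selling coordinates is the unique minimizer of `S₆ - τ S₃`. -/
theorem sellingSum_lt {α β γ τ : ℝ} (hα : 0 ≤ α) (hβ : 0 ≤ β) (hγ : 0 ≤ γ)
    (h : α * β + β * γ + γ * α = 3) (hτ : 0 ≤ τ) (hτ1 : τ ≤ 77 / 200)
    (hne : ¬ (α = 1 ∧ β = 1 ∧ γ = 1)) :
    sellingSum 6 1 1 1 - τ * sellingSum 3 1 1 1 <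
      sellingSum 6 α β γ - τ * sellingSum 3 α β γ := by
  have hσ : 3 < α + β + γ := by
    refine lt_of_le_of_ne (sum_ge_three hα hβ hγ h) fun h3 => hne ?_
    have e : (α - β) ^ 2 + (β - γ) ^ 2 + (γ - α) ^ 2 = 0 := by
      have : (α + β + γ) ^ 2 = 9 := by rw [← h3]; norm_num
      linear_combination 2 * this - 6 * h
    have e1 : α - β = 0 := by
      nlinarith [sq_nonneg (α - β), sq_nonneg (β - γ), sq_nonneg (γ - α)]
    have e2 : β - γ = 0 := by
      nlinarith [sq_nonneg (α - β), sq_nonneg (β - γ), sq_nonneg (γ - α)]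
    exact ⟨by linarith, by linarith, by linarith⟩
  obtain ⟨p0, p1⟩ := pos_of_three_lt hα hβ hγ h hσ
  rcases hτ1.eq_or_lt with rfl | hlt
  · linarith
  · nlinarith [mul_pos (sub_pos.2 hlt) p0, mul_nonneg hτ p1.le]

/-! ### Plane lattices and their energies -/

lemma norm_sq_plane (x : EuclideanSpace ℝ (Fin 2)) : ‖x‖ ^ 2 = x 0 ^ 2 + x 1 ^ 2 := by
  rw [EuclideanSpace.real_norm_sq_eq, Fin.sum_univ_two]

lemma norm_sq_combo (u v : EuclideanSpace ℝ (Fin 2)) (s t : ℝ) :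
    ‖s • u + t • v‖ ^ 2 =
      s ^ 2 * ‖u‖ ^ 2 + 2 * (s * t) * (u 0 * v 0 + u 1 * v 1) + t ^ 2 * ‖v‖ ^ 2 := by
  simp only [norm_sq_plane, PiLp.add_apply, PiLp.smul_apply, smul_eq_mul]
  ring

lemma gram_det (u v : EuclideanSpace ℝ (Fin 2)) :
    ‖u‖ ^ 2 * ‖v‖ ^ 2 - (u 0 * v 0 + u 1 * v 1) ^ 2 = det2 u v ^ 2 := by
  simp only [norm_sq_plane, det2]
  ring

lemma smul_latticeSet (r : ℝ) (u v : EuclideanSpace ℝ (Fin 2)) :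
    r • latticeSet u v = latticeSet (r • u) (r • v) := by
  ext p
  simp only [Set.mem_smul_set, latticeSet, Set.mem_ofPred_eq]
  constructor
  · rintro ⟨-, ⟨m, n, rfl⟩, rfl⟩
    exact ⟨m, n, by module⟩
  · rintro ⟨m, n, rfl⟩
    exact ⟨_, ⟨m, n, rfl⟩, by module⟩

lemma image_latticeSet (O : EuclideanSpace ℝ (Fin 2) ≃ₗᵢ[ℝ] EuclideanSpace ℝ (Fin 2))
    (u v : EuclideanSpace ℝ (Fin 2)) : O '' latticeSet u v = latticeSet (O u) (O v) := by
  ext p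
  simp only [Set.mem_image, latticeSet, Set.mem_ofPred_eq]
  constructor
  · rintro ⟨-, ⟨m, n, rfl⟩, rfl⟩
    exact ⟨m, n, by simp⟩
  · rintro ⟨m, n, rfl⟩
    exact ⟨_, ⟨m, n, rfl⟩, by simp⟩

lemma latticeSet_neg_right (u v : EuclideanSpace ℝ (Fin 2)) :
    latticeSet u (-v) = latticeSet u v := by
  ext p
  simp only [latticeSet, Set.mem_ofPred_eq]
  constructor <;>
  · rintro ⟨m, n, rfl⟩
    exact ⟨m, -n, by push_cast; module⟩

lemma latticeSet_unimodular (u v : EuclideanSpace ℝ (Fin 2)) {a b c d : ℤ}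
    (h : a * d - b * c = 1) :
    latticeSet ((a : ℝ) • u + (b : ℝ) • v) ((c : ℝ) • u + (d : ℝ) • v) = latticeSet u v := by
  have hdet : (a : ℝ) * d - b * c = 1 := by exact_mod_cast h
  ext p
  simp only [latticeSet, Set.mem_ofPred_eq]
  constructor
  · rintro ⟨m, n, rfl⟩
    exact ⟨m * a + n * c, m * b + n * d, by push_cast; module⟩
  · rintro ⟨m, n, rfl⟩
    refine ⟨m * d - n * c, n * a - m * b, ?_⟩
    ext i
    simp only [PiLp.add_apply, PiLp.smul_apply, smul_eq_mul]
    push_cast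
    linear_combination (-m * u i - n * v i) * hdet

/-- Every plane lattice has a basis that is reduced in the sense of Lagrange. -/
lemma exists_reduced_basis {u v : EuclideanSpace ℝ (Fin 2)} (h : det2 u v ≠ 0) :
    ∃ u' v' : EuclideanSpace ℝ (Fin 2), latticeSet u' v' = latticeSet u v ∧
      |det2 u' v'| = |det2 u v| ∧ |u' 0 * v' 0 + u' 1 * v' 1| ≤ ‖u'‖ ^ 2 ∧
      |u' 0 * v' 0 + u' 1 * v' 1| ≤ ‖v'‖ ^ 2 := by
  set B := u 0 * v 0 + u 1 * v 1 with hB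
  set C := ‖v‖ ^ 2 with hC
  have hgram := gram_det u v
  rw [← hB, ← hC] at hgram
  have hD : 0 < |det2 u v| := abs_pos.2 h
  have hC0 : 0 < C := by
    refine lt_of_le_of_ne (by positivity) fun h0 => h ?_
    have : det2 u v ^ 2 = 0 := by nlinarith [sq_nonneg B, sq_nonneg (det2 u v)]
    exact pow_eq_zero_iff (two_ne_zero) |>.1 this
  set z : UpperHalfPlane := ⟨⟨B / C, |det2 u v| / C⟩, div_pos hD hC0⟩ with hz
  obtain ⟨g, hg⟩ := ModularGroup.exists_smul_mem_fd z
  have hdet : g 0 0 * g 1 1 - g 0 1 * g 1 0 = 1 := by rw [← Matrix.det_fin_two]; exact g.det_coe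
  have hw := UpperHalfPlane.coe_specialLinearGroup_apply g z
  have hw0 : ((g • z : UpperHalfPlane) : ℂ) ≠ 0 := (g • z).ne_zero
  obtain ⟨h1, h2⟩ := hg
  rw [← UpperHalfPlane.coe_re] at h2
  generalize ((g • z : UpperHalfPlane) : ℂ) = w at hw hw0 h1 h2
  generalize g 0 0 = a at hdet hw
  generalize g 0 1 = b at hdet hw
  generalize g 1 0 = c at hdet hw
  generalize g 1 1 = d at hdet hw
  simp only [algebraMap_int_eq, eq_intCast, Complex.ofReal_intCast] at hw
  have hden : (c : ℂ) * z + d ≠ 0 := fun h0 => hw0 (by rw [hw, h0, div_zero])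
  rw [eq_div_iff hden] at hw
  have hre := congrArg Complex.re hw
  have him := congrArg Complex.im hw
  simp only [hz, Complex.mul_re, Complex.mul_im, Complex.add_re, Complex.add_im, Complex.intCast_re,
    Complex.intCast_im, zero_mul, sub_zero, add_zero] at hre him
  set x := B / C with hx
  set y := |det2 u v| / C with hy
  have hBx : B = C * x := by rw [hx]; field_simp
  have hA : ‖u‖ ^ 2 = C * (x ^ 2 + y ^ 2) := by
    rw [← sq_abs (det2 u v)] at hgram
    have : ‖u‖ ^ 2 = (B ^ 2 + |det2 u v| ^ 2) / C := by
      rw [eq_div_iff hC0.ne']; linarith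
    rw [this, hx, hy]
    field_simp
  set u' := (a : ℝ) • u + (b : ℝ) • v with hu'
  set v' := (c : ℝ) • u + (d : ℝ) • v with hv'
  set M := C * ((c * x + d) ^ 2 + (c * y) ^ 2) with hM
  have hM0 : 0 ≤ M := by positivity
  have hv2 : ‖v'‖ ^ 2 = M := by
    rw [hv', norm_sq_combo, ← hB, ← hC, hBx, hA, hM]; ring
  have hu2 : ‖u'‖ ^ 2 = (w.re * w.re + w.im * w.im) * M := by
    rw [hu', norm_sq_combo, ← hB, ← hC, hBx, hA, hM]
    linear_combination (-C * (w.re * (c * x + d) - w.im * (c * y) + (a * x + b))) * hre -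
      C * (w.re * (c * y) + w.im * (c * x + d) + a * y) * him
  have hB2 : u' 0 * v' 0 + u' 1 * v' 1 = w.re * M := by
    have : u' 0 * v' 0 + u' 1 * v' 1 =
        a * c * ‖u‖ ^ 2 + (a * d + b * c) * B + b * d * C := by
      simp only [hu', hv', hB, hC, norm_sq_plane, PiLp.add_apply, PiLp.smul_apply, smul_eq_mul]
      ring
    rw [this, hBx, hA, hM]
    linear_combination (-C * (c * x + d)) * hre - C * (c * y) * him
  have hL : latticeSet u' v' = latticeSet u v := latticeSet_unimodular u v (by linarith)
  have hdet' : det2 u' v' = det2 u v := by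
    have e : (a : ℝ) * d - b * c = 1 := by exact_mod_cast hdet
    simp only [det2, hu', hv', PiLp.add_apply, PiLp.smul_apply, smul_eq_mul]
    linear_combination (u 0 * v 1 - u 1 * v 0) * e
  rw [Complex.normSq_apply] at h1
  have hle : w.re * M ≤ M ∧ -M ≤ w.re * M := by
    have hp := abs_le.1 h2
    have hp1 := mul_le_mul_of_nonneg_right hp.1 hM0
    have hp2 := mul_le_mul_of_nonneg_right hp.2 hM0
    clear_value M
    constructor <;> linarith only [hp1, hp2, hM0]
  have hv : |u' 0 * v' 0 + u' 1 * v' 1| ≤ M := by rw [hB2]; exact abs_le.2 hle.symm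
  refine ⟨u', v', hL, by rw [hdet'], hv.trans ?_, hv.trans_eq hv2.symm⟩
  rw [hu2]
  exact le_mul_of_one_le_left hM0 h1

/-- Every plane lattice has a reduced basis with an acute angle. -/
lemma exists_acute_reduced_basis {u v : EuclideanSpace ℝ (Fin 2)} (h : det2 u v ≠ 0) :
    ∃ u' v' : EuclideanSpace ℝ (Fin 2), latticeSet u' v' = latticeSet u v ∧
      |det2 u' v'| = |det2 u v| ∧ 0 ≤ u' 0 * v' 0 + u' 1 * v' 1 ∧
      u' 0 * v' 0 + u' 1 * v' 1 ≤ ‖u'‖ ^ 2 ∧ u' 0 * v' 0 + u' 1 * v' 1 ≤ ‖v'‖ ^ 2 := by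
  obtain ⟨u', v', hL, hdet, hu, hv⟩ := exists_reduced_basis h
  rcases le_total 0 (u' 0 * v' 0 + u' 1 * v' 1) with h0 | h0
  · rw [abs_of_nonneg h0] at hu hv
    exact ⟨u', v', hL, hdet, h0, hu, hv⟩
  · rw [abs_of_nonpos h0] at hu hv
    have hneg : u' 0 * (-v') 0 + u' 1 * (-v') 1 = -(u' 0 * v' 0 + u' 1 * v' 1) := by
      rw [PiLp.neg_apply, PiLp.neg_apply]; ring
    have hdn : det2 u' (-v') = -det2 u' v' := by
      simp only [det2, PiLp.neg_apply]; ring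
    refine ⟨u', -v', (latticeSet_neg_right _ _).trans hL, by rw [hdn, abs_neg, hdet], ?_, ?_, ?_⟩
    · rw [hneg]; linarith
    · rwa [hneg]
    · rwa [hneg, norm_neg]

/-- The Lennard-Jones energy in terms of the Epstein sums of the Gram form. -/
lemma LJenergy_latticeSet {u v : EuclideanSpace ℝ (Fin 2)} {c α β γ : ℝ} (a b : ℝ) (hc : 0 < c)
    (hα : 0 ≤ α) (hβ : 0 ≤ β) (hγ : 0 ≤ γ) (h : α * β + β * γ + γ * α = 3)
    (hq : ∀ m n : ℤ, ‖(m : ℝ) • u + (n : ℝ) • v‖ ^ 2 = c * sellingForm α β γ (m, n)) :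
    LJenergy a b 12 6 (latticeSet u v) =
      a * c⁻¹ ^ 6 * sellingSum 6 α β γ - b * c⁻¹ ^ 3 * sellingSum 3 α β γ := by
  set φ : ℤ × ℤ → EuclideanSpace ℝ (Fin 2) := fun x => (x.1 : ℝ) • u + (x.2 : ℝ) • v with hφ
  have hzero : ∀ x, φ x = 0 → x = 0 := fun x hx => by
    by_contra hne
    have h1 := hq x.1 x.2
    have h2 := mul_pos hc (sellingForm_pos hα hβ hγ h hne)
    simp only [hφ] at hx
    rw [hx, norm_zero] at h1
    simp only [Prod.mk.eta] at h1
    linarith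
  have hinj : Function.Injective φ := fun x y hxy => by
    refine sub_eq_zero.1 (hzero (x - y) ?_)
    have : φ (x - y) = φ x - φ y := by simp only [hφ, Prod.fst_sub, Prod.snd_sub]; push_cast; module
    rw [this, hxy, sub_self]
  unfold LJenergy
  rw [tsum_subtype (latticeSet u v \ {0})
    fun p => a * ‖p‖ ^ (-12 : ℝ) - b * ‖p‖ ^ (-6 : ℝ), ← hinj.tsum_eq]
  · have hterm : ∀ x, (latticeSet u v \ {0}).indicator
        (fun p => a * ‖p‖ ^ (-12 : ℝ) - b * ‖p‖ ^ (-6 : ℝ)) (φ x) =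
        a * c⁻¹ ^ 6 * (sellingForm α β γ x)⁻¹ ^ 6 - b * c⁻¹ ^ 3 * (sellingForm α β γ x)⁻¹ ^ 3 := by
      intro x
      rcases eq_or_ne x 0 with rfl | hx
      · have : φ 0 = 0 := by simp [hφ]
        simp [this, sellingForm_zero]
      · have hmem : φ x ∈ latticeSet u v \ {0} := ⟨⟨x.1, x.2, rfl⟩, fun h0 => hx (hzero x h0)⟩
        have hn : ‖φ x‖ ^ 2 = c * sellingForm α β γ x := hq x.1 x.2
        have e12 : ‖φ x‖ ^ (-12 : ℝ) = (c * sellingForm α β γ x)⁻¹ ^ 6 := by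
          rw [Real.rpow_neg (norm_nonneg _), ← hn, inv_pow, ← pow_mul]
          exact_mod_cast rfl
        have e6 : ‖φ x‖ ^ (-6 : ℝ) = (c * sellingForm α β γ x)⁻¹ ^ 3 := by
          rw [Real.rpow_neg (norm_nonneg _), ← hn, inv_pow, ← pow_mul]
          exact_mod_cast rfl
        rw [Set.indicator_of_mem hmem, e12, e6]
        simp only [mul_inv, mul_pow]
        ring
    simp_rw [hterm]
    rw [Summable.tsum_sub, tsum_mul_left, tsum_mul_left]
    · rfl
    · exact (summable_inv_sellingForm_pow hα hβ hγ h (by norm_num)).mul_left _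
    · exact (summable_inv_sellingForm_pow hα hβ hγ h le_rfl).mul_left _
  · intro p hp
    obtain ⟨⟨m, n, rfl⟩, -⟩ := Set.indicator_apply_ne_zero.1 hp |>.1
    exact ⟨(m, n), rfl⟩

/-- Two bases with the same Gram form are related by a linear isometry. -/
lemma exists_isometry {u v s t : EuclideanSpace ℝ (Fin 2)} (hst : det2 s t ≠ 0)
    (hq : ∀ m n : ℤ, ‖(m : ℝ) • u + (n : ℝ) • v‖ ^ 2 = ‖(m : ℝ) • s + (n : ℝ) • t‖ ^ 2) :
    ∃ O : EuclideanSpace ℝ (Fin 2) ≃ₗᵢ[ℝ] EuclideanSpace ℝ (Fin 2), O s = u ∧ O t = v := by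
  have hA : ‖u‖ ^ 2 = ‖s‖ ^ 2 := by simpa using hq 1 0
  have hC : ‖v‖ ^ 2 = ‖t‖ ^ 2 := by simpa using hq 0 1
  have hB : u 0 * v 0 + u 1 * v 1 = s 0 * t 0 + s 1 * t 1 := by
    have := hq 1 1
    rw [norm_sq_combo, norm_sq_combo, hA, hC] at this
    push_cast at this
    linarith
  let f : EuclideanSpace ℝ (Fin 2) →ₗ[ℝ] EuclideanSpace ℝ (Fin 2) := IsLinearMap.mk'
    (fun x => ((x 0 * t 1 - x 1 * t 0) / det2 s t) • u + ((s 0 * x 1 - s 1 * x 0) / det2 s t) • v)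
    { map_add := fun x y => by
        simp only [PiLp.add_apply]
        module
      map_smul := fun r x => by
        simp only [PiLp.smul_apply, smul_eq_mul]
        module }
  have hf : ∀ x, ‖f x‖ = ‖x‖ := fun x => by
    have hx : x = ((x 0 * t 1 - x 1 * t 0) / det2 s t) • s +
        ((s 0 * x 1 - s 1 * x 0) / det2 s t) • t := by
      ext i
      simp only [PiLp.add_apply, PiLp.smul_apply, smul_eq_mul]
      field_simp
      fin_cases i <;> simp [det2] <;> ring
    refine (sq_eq_sq₀ (norm_nonneg _) (norm_nonneg _)).1 ?_
    conv_rhs => rw [hx]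
    change ‖((x 0 * t 1 - x 1 * t 0) / det2 s t) • u +
      ((s 0 * x 1 - s 1 * x 0) / det2 s t) • v‖ ^ 2 = _
    rw [norm_sq_combo, norm_sq_combo, hA, hB, hC]
  refine ⟨LinearIsometry.toLinearIsometryEquiv ⟨f, hf⟩ rfl, ?_, ?_⟩
  · change ((s 0 * t 1 - s 1 * t 0) / det2 s t) • u + ((s 0 * s 1 - s 1 * s 0) / det2 s t) • v = u
    rw [← det2, div_self hst, mul_comm (s 0), sub_self, zero_div, zero_smul, add_zero, one_smul]
  · change ((t 0 * t 1 - t 1 * t 0) / det2 s t) • u + ((s 0 * t 1 - s 1 * t 0) / det2 s t) • v = v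
    rw [mul_comm (t 0), sub_self, zero_div, zero_smul, zero_add, ← det2, div_self hst, one_smul]

/-- Every lattice of co-volume `V` has a basis whose Gram form has nonnegative Selling
coordinates. -/
lemma IsLattice2OfCovol.exists_sellingForm {L : Set (EuclideanSpace ℝ (Fin 2))} {V : ℝ}
    (hL : IsLattice2OfCovol L V) :
    ∃ (u v : EuclideanSpace ℝ (Fin 2)) (α β γ : ℝ), L = latticeSet u v ∧ 0 ≤ α ∧ 0 ≤ β ∧ 0 ≤ γ ∧
      α * β + β * γ + γ * α = 3 ∧ ∀ m n : ℤ,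
        ‖(m : ℝ) • u + (n : ℝ) • v‖ ^ 2 = V / √3 * sellingForm α β γ (m, n) := by
  obtain ⟨u₀, v₀, h0, hV, rfl⟩ := hL
  obtain ⟨u, v, hL, hdet, hB0, hBu, hBv⟩ := exists_acute_reduced_basis h0
  have hV0 : 0 < V := hV ▸ abs_pos.2 h0
  have h3 : √3 ^ 2 = (3 : ℝ) := Real.sq_sqrt (by norm_num)
  have hgram := gram_det u v
  rw [← sq_abs (det2 u v), hdet, hV] at hgram
  have hk : 0 ≤ √3 / V := by positivity
  refine ⟨u, v, √3 / V * (‖u‖ ^ 2 - (u 0 * v 0 + u 1 * v 1)),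
    √3 / V * (‖v‖ ^ 2 - (u 0 * v 0 + u 1 * v 1)), √3 / V * (u 0 * v 0 + u 1 * v 1), hL.symm,
    mul_nonneg hk (by linarith), mul_nonneg hk (by linarith), mul_nonneg hk hB0, ?_, fun m n => ?_⟩
  · field_simp
    rw [h3]
    linear_combination 3 * hgram
  · rw [norm_sq_combo]
    simp only [sellingForm]
    field_simp
    ring

lemma smul_triangularLattice {V : ℝ} (hV : 0 < V) :
    ∃ u v : EuclideanSpace ℝ (Fin 2), √V • triangularLattice = latticeSet u v ∧ det2 u v ≠ 0 ∧
      ∀ m n : ℤ, ‖(m : ℝ) • u + (n : ℝ) • v‖ ^ 2 = V / √3 * sellingForm 1 1 1 (m, n) := by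
  refine ⟨_, _, smul_latticeSet _ _ _, ?_, fun m n => ?_⟩
  · have : √V ≠ 0 := by positivity
    have : √(2 / √3) ≠ 0 := by positivity
    simp only [det2, vec2, PiLp.smul_apply, smul_eq_mul]
    simp
    positivity
  · have hV2 : √V ^ 2 = V := Real.sq_sqrt hV.le
    have hr : √(2 / √3) ^ 2 = 2 / √3 := Real.sq_sqrt (by positivity)
    have h3 : √3 ^ 2 = (3 : ℝ) := Real.sq_sqrt (by norm_num)
    have e : ∀ x y : ℝ, ‖vec2 x y‖ ^ 2 = x ^ 2 + y ^ 2 := fun x y => by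
      rw [norm_sq_plane]; simp [vec2]
    have e' : (m : ℝ) • √V • √(2 / √3) • vec2 1 0 +
        (n : ℝ) • √V • √(2 / √3) • vec2 (1 / 2) (√3 / 2) =
        (√V * √(2 / √3)) • vec2 (m + n / 2) (n * √3 / 2) := by
      ext i
      fin_cases i <;> simp [vec2] <;> ring
    rw [e', norm_smul, mul_pow, e, norm_mul, mul_pow, Real.norm_eq_abs, Real.norm_eq_abs, sq_abs,
      sq_abs, hV2, hr]
    simp only [sellingForm]
    rw [div_pow, mul_pow, h3]
    ring

/-- Optimality at fixed high density for the classical (12,6) Lennard-Jones energy: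
for any `a, b > 0` and `0 < V ≤ (2a/b)^{1/3}`, the triangular lattice `√V·A₂` is the
unique minimizer, up to rotation, of `E_f` among lattices of co-volume `V`. -/
theorem LJ_12_6_fixed_density_minimality
    (a b : ℝ) (ha : 0 < a) (hb : 0 < b) (V : ℝ) (hV0 : 0 < V)
    (hV : V ≤ (2 * a / b) ^ ((1 : ℝ) / 3)) :
    ∀ L : Set (EuclideanSpace ℝ (Fin 2)), IsLattice2OfCovol L V →
      LJenergy a b 12 6 (Real.sqrt V • triangularLattice) ≤ LJenergy a b 12 6 L ∧
      (LJenergy a b 12 6 L = LJenergy a b 12 6 (Real.sqrt V • triangularLattice) ↔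
        IsRotationOf L (Real.sqrt V • triangularLattice)) := by
  intro L hL
  obtain ⟨u, v, α, β, γ, rfl, hα, hβ, hγ, h, hq⟩ := hL.exists_sellingForm
  obtain ⟨s, t, hT, hst, hqT⟩ := smul_triangularLattice hV0
  rw [hT]
  set c := V / √3 with hc
  have hc0 : 0 < c := by positivity
  have h111 : (1 : ℝ) * 1 + 1 * 1 + 1 * 1 = 3 := by norm_num
  have hET := LJenergy_latticeSet a b hc0 zero_le_one zero_le_one zero_le_one h111 hqT
  have hE := LJenergy_latticeSet a b hc0 hα hβ hγ h hq
  have hrot : IsRotationOf (latticeSet u v) (latticeSet s t) →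
      LJenergy a b 12 6 (latticeSet u v) = LJenergy a b 12 6 (latticeSet s t) := by
    rintro ⟨O, hO⟩
    rw [hO, image_latticeSet, hET]
    refine LJenergy_latticeSet a b hc0 zero_le_one zero_le_one zero_le_one h111 fun m n => ?_
    rw [← hqT, ← map_smul, ← map_smul, ← map_add, O.norm_map]
  by_cases h1 : α = 1 ∧ β = 1 ∧ γ = 1
  · obtain ⟨rfl, rfl, rfl⟩ := h1
    obtain ⟨O, hOs, hOt⟩ := exists_isometry hst fun m n => (hq m n).trans (hqT m n).symm
    exact ⟨(hET.trans hE.symm).le, fun _ => ⟨O, by rw [image_latticeSet, hOs, hOt]⟩, hrot⟩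
  · have hτ : b * c ^ 3 / a ≤ 77 / 200 := by
      have hV3 : V ^ 3 ≤ 2 * a / b := by
        have h0 : 0 ≤ 2 * a / b := by positivity
        calc V ^ 3 ≤ ((2 * a / b) ^ ((1 : ℝ) / 3)) ^ 3 := by gcongr
          _ = 2 * a / b := by
            rw [← Real.rpow_natCast, ← Real.rpow_mul h0]
            norm_num
      have h3 : √3 ^ 2 = (3 : ℝ) := Real.sq_sqrt (by norm_num)
      have h173 : 1732 / 1000 ≤ √3 := Real.le_sqrt_of_sq_le (by norm_num)
      have h33 : √3 ^ 3 = 3 * √3 := by rw [pow_succ, h3]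
      rw [le_div_iff₀ hb] at hV3
      rw [hc, div_pow, h33, div_le_iff₀ ha, ← mul_div_assoc, div_le_iff₀ (by positivity)]
      nlinarith
    have hlt := sellingSum_lt hα hβ hγ h (τ := b * c ^ 3 / a) (by positivity) hτ h1
    have hlt' : LJenergy a b 12 6 (latticeSet s t) < LJenergy a b 12 6 (latticeSet u v) := by
      have e : ∀ x y : ℝ, a * c⁻¹ ^ 6 * x - b * c⁻¹ ^ 3 * y =
          a * c⁻¹ ^ 6 * (x - b * c ^ 3 / a * y) := fun x y => by
        field_simp
      rw [hET, hE, e, e]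
      gcongr
    exact ⟨hlt'.le, fun he => absurd he hlt'.ne', hrot⟩
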